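/- arXiv:2505.09535 — 5 statements merged into one kernel-verified Lean document; each statement's English description precedes it below -/
import Mathlib

section
/- For every nonnegative integer r and all rational numbers t and j, one has α(r,t,j) = r! · C(t,r) · ∑_{a=0}^{r} (−2)^a · C(j,a) · C(t+r−a, r−a). (This is the coefficient form of the generating identity ∑_{r≥0} α(r,t,j)/(r!·C(t,r)) · z^r = (1−2z)^j/(1−z)^{t+1} from the paper; in particular, if t is a nonnegative integer then α(r,t,j) = 0 for all r > t.) -/
/-- The generalized binomial coefficient `C(x,m) = x(x-1)⋯(x-m+1)/m!`. -/
noncomputable def gbinom (x : ℚ) (m : ℕ) : ℚ :=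
  (∏ i ∈ Finset.range m, (x - (i : ℚ))) / (m.factorial : ℚ)

/-- `α(r,t,j) = ∑_{h=0}^{r} (−1)^h · ((2h)!·(2(r−h))!)/(h!·(r−h)!) · C(j,2h) · C(t+r−j,2(r−h))`. -/
noncomputable def alphaQ (r : ℕ) (t j : ℚ) : ℚ :=
  ∑ h ∈ Finset.range (r + 1),
    (-1 : ℚ) ^ h * (((2 * h).factorial : ℚ) * ((2 * (r - h)).factorial : ℚ)) /
        ((h.factorial : ℚ) * ((r - h).factorial : ℚ)) *
      gbinom j (2 * h) * gbinom (t + (r : ℚ) - j) (2 * (r - h))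

lemma gbinom_zero (x : ℚ) : gbinom x 0 = 1 := by
  simp [gbinom]

lemma succ_mul_gbinom_succ (x : ℚ) (m : ℕ) :
    ((m : ℚ) + 1) * gbinom x (m + 1) = (x - m) * gbinom x m := by
  have := Nat.factorial_ne_zero m
  rw [gbinom, gbinom, Finset.prod_range_succ, Nat.factorial_succ]
  push_cast
  field_simp

lemma succ_mul_gbinom_succ' (x : ℚ) (m : ℕ) :
    ((m : ℚ) + 1) * gbinom x (m + 1) = x * gbinom (x - 1) m := by
  have := Nat.factorial_ne_zero m
  have h : ∏ i ∈ Finset.range m, (x - ((i + 1 : ℕ) : ℚ)) =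
      ∏ i ∈ Finset.range m, (x - 1 - (i : ℚ)) :=
    Finset.prod_congr rfl fun i _ => by push_cast; ring
  rw [gbinom, gbinom, Finset.prod_range_succ', Nat.factorial_succ, h]
  push_cast
  field_simp
  ring

lemma gbinom_add_one (x : ℚ) (m : ℕ) :
    gbinom (x + 1) (m + 1) = gbinom x (m + 1) + gbinom x m := by
  have h1 := succ_mul_gbinom_succ x m
  have h2 := succ_mul_gbinom_succ' (x + 1) m
  rw [add_sub_cancel_right] at h2
  have h0 : (m : ℚ) + 1 ≠ 0 := by positivity
  apply mul_left_cancel₀ h0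
  linear_combination h2 - h1

lemma factorial_mul_gbinom_add_two (x : ℚ) (m : ℕ) :
    ((m + 2).factorial : ℚ) * gbinom x (m + 2) =
      x * (x - 1) * ((m.factorial : ℚ) * gbinom (x - 2) m) := by
  have h1 := succ_mul_gbinom_succ' x (m + 1)
  have h2 := succ_mul_gbinom_succ' (x - 1) m
  rw [show x - 1 - 1 = x - 2 by ring] at h2
  simp only [Nat.factorial_succ]
  push_cast at h1 ⊢
  linear_combination ((m : ℚ) + 1) * m.factorial * h1 + x * m.factorial * h2

/-- The coefficient of `x ^ r` in `(1 - x) ^ j * (1 + x) ^ n`, obtained by expanding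
`1 - x = (1 + x) - 2 * x`. -/
noncomputable def krawtchouk (r : ℕ) (j n : ℚ) : ℚ :=
  ∑ a ∈ Finset.range (r + 1), (-2 : ℚ) ^ a * gbinom j a * gbinom (j + n - a) (r - a)

lemma krawtchouk_zero (j n : ℚ) : krawtchouk 0 j n = 1 := by
  simp [krawtchouk, gbinom_zero]

lemma krawtchouk_add_one_right (r : ℕ) (j n : ℚ) :
    krawtchouk (r + 1) j (n + 1) = krawtchouk (r + 1) j n + krawtchouk r j n := by
  simp only [krawtchouk]
  rw [Finset.sum_range_succ _ (r + 1), Finset.sum_range_succ _ (r + 1), add_right_comm,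
    ← Finset.sum_add_distrib]
  congr 1
  · refine Finset.sum_congr rfl fun a ha => ?_
    obtain ⟨c, rfl⟩ := Nat.exists_eq_add_of_le (Finset.mem_range_succ_iff.1 ha)
    rw [show a + c + 1 - a = c + 1 by omega, show a + c - a = c by omega,
      show j + (n + 1) - (a : ℚ) = j + n - a + 1 by ring, gbinom_add_one]
    ring
  · simp [gbinom_zero]

lemma krawtchouk_add_one_left (r : ℕ) (j n : ℚ) :
    krawtchouk (r + 1) (j + 1) n = krawtchouk (r + 1) j n - krawtchouk r j n := by
  have h : krawtchouk (r + 1) (j + 1) n =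
      krawtchouk (r + 1) j (n + 1) - 2 * krawtchouk r j n := by
    simp only [krawtchouk]
    rw [Finset.sum_range_succ' _ (r + 1), Finset.sum_range_succ' _ (r + 1), eq_sub_iff_add_eq,
      add_right_comm, Finset.mul_sum, ← Finset.sum_add_distrib]
    congr 1
    · refine Finset.sum_congr rfl fun a _ => ?_
      rw [gbinom_add_one, Nat.add_sub_add_right]
      push_cast
      rw [show j + 1 + n - ((a : ℚ) + 1) = j + n - a by ring,
        show j + (n + 1) - ((a : ℚ) + 1) = j + n - a by ring]
      ring
    · simp only [gbinom_zero]
      ring_nf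
  rw [h, krawtchouk_add_one_right]
  ring

lemma sum_mul_gbinom (r : ℕ) (j : ℚ) (f : ℕ → ℚ) :
    ∑ a ∈ Finset.range (r + 2), (-2 : ℚ) ^ a * (a * gbinom j a) * f a =
      -2 * j * ∑ a ∈ Finset.range (r + 1), (-2 : ℚ) ^ a * gbinom (j - 1) a * f (a + 1) := by
  rw [Finset.sum_range_succ' _ (r + 1), Finset.mul_sum]
  simp only [Nat.cast_zero, zero_mul, mul_zero, add_zero]
  refine Finset.sum_congr rfl fun a _ => ?_
  push_cast
  rw [succ_mul_gbinom_succ']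
  ring

/-- Coefficient form of `G' = n * (1 - x) ^ j * (1 + x) ^ (n - 1) - j * (1 - x) ^ (j - 1) *
(1 + x) ^ n` for `G = (1 - x) ^ j * (1 + x) ^ n`. -/
lemma succ_mul_krawtchouk_succ (r : ℕ) (j n : ℚ) :
    ((r : ℚ) + 1) * krawtchouk (r + 1) j n =
      n * krawtchouk r j (n - 1) - j * krawtchouk r (j - 1) n := by
  have hsplit : ((r : ℚ) + 1) * krawtchouk (r + 1) j n =
      ∑ a ∈ Finset.range (r + 2),
        (-2 : ℚ) ^ a * (a * gbinom j a) * gbinom (j + n - a) (r + 1 - a) +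
      ∑ a ∈ Finset.range (r + 1),
        (-2 : ℚ) ^ a * gbinom j a * ((j + n - a) * gbinom (j + (n - 1) - a) (r - a)) := by
    rw [krawtchouk, Finset.sum_range_succ _ (r + 1), Finset.sum_range_succ _ (r + 1),
      add_right_comm, ← Finset.sum_add_distrib, mul_add, Finset.mul_sum]
    congr 1
    · refine Finset.sum_congr rfl fun a ha => ?_
      obtain ⟨c, rfl⟩ := Nat.exists_eq_add_of_le (Finset.mem_range_succ_iff.1 ha)
      rw [show a + c + 1 - a = c + 1 by omega, show a + c - a = c by omega,
        show j + (n - 1) - (a : ℚ) = j + n - a - 1 by ring, ← succ_mul_gbinom_succ']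
      push_cast
      ring
    · push_cast
      ring
  have hfirst : ∑ a ∈ Finset.range (r + 2),
      (-2 : ℚ) ^ a * (a * gbinom j a) * gbinom (j + n - a) (r + 1 - a) =
      -2 * j * krawtchouk r (j - 1) n := by
    rw [sum_mul_gbinom r j fun a => gbinom (j + n - a) (r + 1 - a), krawtchouk]
    congr 1
    refine Finset.sum_congr rfl fun a _ => ?_
    rw [Nat.add_sub_add_right]
    push_cast
    rw [show j + n - ((a : ℚ) + 1) = j - 1 + n - a by ring]
  have hsecond : ∑ a ∈ Finset.range (r + 1),
        (-2 : ℚ) ^ a * gbinom j a * ((j + n - a) * gbinom (j + (n - 1) - a) (r - a)) =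
      (j + n) * krawtchouk r j (n - 1) -
        ∑ a ∈ Finset.range (r + 1),
          (-2 : ℚ) ^ a * (a * gbinom j a) * gbinom (j + (n - 1) - a) (r - a) := by
    rw [krawtchouk, Finset.mul_sum, ← Finset.sum_sub_distrib]
    exact Finset.sum_congr rfl fun a _ => by ring
  rw [hsplit, hfirst, hsecond]
  cases r with
  | zero =>
    simp only [krawtchouk_zero, zero_add, Finset.sum_range_one, Nat.cast_zero]
    ring
  | succ s =>
    have hthird : ∑ a ∈ Finset.range (s + 2),
        (-2 : ℚ) ^ a * (a * gbinom j a) * gbinom (j + (n - 1) - a) (s + 1 - a) =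
        -2 * j * krawtchouk s (j - 1) (n - 1) := by
      rw [sum_mul_gbinom s j fun a => gbinom (j + (n - 1) - a) (s + 1 - a), krawtchouk]
      congr 1
      refine Finset.sum_congr rfl fun a _ => ?_
      rw [Nat.add_sub_add_right]
      push_cast
      rw [show j + (n - 1) - ((a : ℚ) + 1) = j - 1 + (n - 1) - a by ring]
    rw [hthird]
    have hr := krawtchouk_add_one_right s (j - 1) (n - 1)
    have hl := krawtchouk_add_one_left s (j - 1) (n - 1)
    rw [sub_add_cancel] at hr hl
    linear_combination j * hl - j * hr

lemma krawtchouk_second_order (r : ℕ) (j n : ℚ) :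
    ((r : ℚ) + 1) * (j + n - 1 - r) * krawtchouk (r + 1) j n =
      n * (n - 1) * krawtchouk r j (n - 2) - j * (j - 1) * krawtchouk r (j - 2) n := by
  have h := succ_mul_krawtchouk_succ r j n
  cases r with
  | zero =>
    simp only [krawtchouk_zero, Nat.cast_zero] at h ⊢
    linear_combination (j + n - 1) * h
  | succ s =>
    have hn := succ_mul_krawtchouk_succ s j (n - 1)
    have hj := succ_mul_krawtchouk_succ s (j - 1) n
    have hr := krawtchouk_add_one_right s j (n - 2)
    have hl := krawtchouk_add_one_left s (j - 2) n
    have hr' := krawtchouk_add_one_right s (j - 1) (n - 1)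
    have hl' := krawtchouk_add_one_left s (j - 1) (n - 1)
    rw [show n - 1 - 1 = n - 2 by ring] at hn
    rw [show j - 1 - 1 = j - 2 by ring] at hj
    rw [show n - 2 + 1 = n - 1 by ring] at hr
    rw [show j - 2 + 1 = j - 1 by ring] at hl
    rw [sub_add_cancel] at hr' hl'
    push_cast at h ⊢
    linear_combination (j + n - 1 - (s + 1)) * h - n * hn + j * hj + n * (n - 1) * hr -
      j * (j - 1) * hl + n * j * hl' - n * j * hr'

lemma succ_mul_alphaQ_succ (r : ℕ) (t j : ℚ) :
    ((r : ℚ) + 1) * alphaQ (r + 1) t j =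
      (t + r + 1 - j) * (t + r - j) * alphaQ r (t - 1) j -
        j * (j - 1) * alphaQ r (t - 1) (j - 2) := by
  have hsplit : ((r : ℚ) + 1) * alphaQ (r + 1) t j =
      ∑ h ∈ Finset.range (r + 2), (h : ℚ) *
        ((-1 : ℚ) ^ h * (((2 * h).factorial : ℚ) * ((2 * (r + 1 - h)).factorial : ℚ)) /
          ((h.factorial : ℚ) * ((r + 1 - h).factorial : ℚ)) *
          gbinom j (2 * h) * gbinom (t + r + 1 - j) (2 * (r + 1 - h))) +
      ∑ h ∈ Finset.range (r + 2), ((r : ℚ) + 1 - h) *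
        ((-1 : ℚ) ^ h * (((2 * h).factorial : ℚ) * ((2 * (r + 1 - h)).factorial : ℚ)) /
          ((h.factorial : ℚ) * ((r + 1 - h).factorial : ℚ)) *
          gbinom j (2 * h) * gbinom (t + r + 1 - j) (2 * (r + 1 - h))) := by
    rw [← Finset.sum_add_distrib, alphaQ, Finset.mul_sum]
    refine Finset.sum_congr rfl fun h _ => ?_
    push_cast
    rw [← add_assoc]
    ring
  rw [hsplit, Finset.sum_range_succ' _ (r + 1), Finset.sum_range_succ _ (r + 1), add_comm,
    sub_eq_add_neg (_ * alphaQ _ _ _), alphaQ, alphaQ, Finset.mul_sum, Finset.mul_sum, ← Finset.sum_neg_distrib]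
  simp only [Nat.cast_zero, zero_mul, add_zero, Nat.cast_add, Nat.cast_one, sub_self]
  congr 1
  · refine Finset.sum_congr rfl fun h hh => ?_
    obtain ⟨c, rfl⟩ := Nat.exists_eq_add_of_le (Finset.mem_range_succ_iff.1 hh)
    have := Nat.factorial_ne_zero h
    have := Nat.factorial_ne_zero c
    have hg := factorial_mul_gbinom_add_two (t + ((h + c : ℕ) : ℚ) + 1 - j) (2 * c)
    rw [show h + c + 1 - h = c + 1 by omega, show h + c - h = c by omega,
      Nat.factorial_succ c, mul_add_one 2 c]
    push_cast at hg ⊢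
    rw [show t - 1 + ((h : ℚ) + c) - j = t + (h + c) + 1 - j - 2 by ring]
    field_simp
    linear_combination ((c : ℚ) + 1) * gbinom j (2 * h) * hg
  · refine Finset.sum_congr rfl fun h _ => ?_
    have := Nat.factorial_ne_zero h
    have := Nat.factorial_ne_zero (r - h)
    have hg := factorial_mul_gbinom_add_two j (2 * h)
    rw [Nat.add_sub_add_right, Nat.factorial_succ h, mul_add_one 2 h, pow_succ,
      show t - 1 + (r : ℚ) - (j - 2) = t + r + 1 - j by ring]
    push_cast
    field_simp
    linear_combination -gbinom (t + r + 1 - j) (2 * (r - h)) * hg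

lemma alphaQ_eq_krawtchouk (r : ℕ) (t j : ℚ) :
    alphaQ r t j = (r.factorial : ℚ) * gbinom t r * krawtchouk r j (t + r - j) := by
  induction r generalizing t j with
  | zero => simp [alphaQ, gbinom_zero, krawtchouk_zero]
  | succ r ih =>
    have h0 : (r : ℚ) + 1 ≠ 0 := by positivity
    apply mul_left_cancel₀ h0
    have hk := krawtchouk_second_order r j (t + r + 1 - j)
    have hg := succ_mul_gbinom_succ' t r
    rw [succ_mul_alphaQ_succ, ih, ih, Nat.factorial_succ]
    push_cast
    rw [show t - 1 + (r : ℚ) - j = t + r + 1 - j - 2 by ring,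
      show t - 1 + (r : ℚ) - (j - 2) = t + r + 1 - j by ring, ← add_assoc]
    linear_combination -(r.factorial : ℚ) * gbinom (t - 1) r * hk -
      ((r : ℚ) + 1) * r.factorial * krawtchouk (r + 1) j (t + r + 1 - j) * hg

/-- Coefficient form of `∑_{r≥0} α(r,t,j)/(r!·C(t,r)) · z^r = (1−2z)^j/(1−z)^{t+1}`. -/
theorem alphaQ_eq (r : ℕ) (t j : ℚ) :
    alphaQ r t j =
      (r.factorial : ℚ) * gbinom t r *
        ∑ a ∈ Finset.range (r + 1),
          (-2 : ℚ) ^ a * gbinom j a * gbinom (t + (r : ℚ) - (a : ℚ)) (r - a) := by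
  rw [alphaQ_eq_krawtchouk, krawtchouk, add_sub_cancel]
end

section
/- For all nonnegative integers k, r, t one has ∑_{j=0}^{k} C(k,j) · α(r,t,j) = 2^k · r! · C(t,r) · C(t+r−k, r), where on the right C(t+r−k, r) is the generalized binomial coefficient of the (possibly negative) integer t+r−k. -/
/-- The falling factorial `x(x-1)⋯(x-m+1)`. -/
def fallingQ (x : ℚ) (m : ℕ) : ℚ :=
  ∏ i ∈ Finset.range m, (x - (i : ℚ))

lemma gbinom_eq (x : ℚ) (m : ℕ) : gbinom x m = fallingQ x m / (m.factorial : ℚ) := rfl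

lemma fallingQ_zero (x : ℚ) : fallingQ x 0 = 1 := by simp [fallingQ]

lemma fallingQ_succ (x : ℚ) (m : ℕ) : fallingQ x (m + 1) = x * fallingQ (x - 1) m := by
  rw [fallingQ, Finset.prod_range_succ', mul_comm, fallingQ]
  congr 1
  · simp
  · refine Finset.prod_congr rfl fun i _ => ?_
    push_cast
    ring

/-- The action of `∂/∂x` on the factor `(1+x)^c` of `(1+x)^c (2+x+y)^d`, transposed to functions
of the exponents `(c, d)`. -/
def lowerLeft : Module.End ℚ (ℚ → ℕ → ℚ) where
  toFun f c d := c * f (c - 1) d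
  map_add' f g := by ext; simp [mul_add]
  map_smul' a f := by ext; simp [mul_left_comm]

/-- The action of `∂/∂y` on `(1+x)^c (2+x+y)^d`, transposed to functions of the exponents
`(c, d)`. -/
def lowerRight : Module.End ℚ (ℚ → ℕ → ℚ) where
  toFun f c d := d * f c (d - 1)
  map_add' f g := by ext; simp [mul_add]
  map_smul' a f := by ext; simp [mul_left_comm]

lemma lowerLeft_apply (f : ℚ → ℕ → ℚ) (c : ℚ) (d : ℕ) :
    lowerLeft f c d = c * f (c - 1) d := rfl

lemma lowerRight_apply (f : ℚ → ℕ → ℚ) (c : ℚ) (d : ℕ) :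
    lowerRight f c d = d * f c (d - 1) := rfl

lemma commute_lowerLeft_lowerRight : Commute lowerLeft lowerRight := by
  refine LinearMap.ext fun f => ?_
  ext c d
  simp only [Module.End.mul_apply, lowerLeft_apply, lowerRight_apply]
  ring

/-- The value at the origin of `∂_y^a ∂_x^b` applied to `(1+x)^c (2+x+y)^d`. -/
def binomMoment (a b : ℕ) (c : ℚ) (d : ℕ) : ℚ :=
  ∑ j ∈ Finset.range (d + 1), (d.choose j : ℚ) * fallingQ j a * fallingQ (c + d - j) b

lemma lowerRight_binomMoment (a b : ℕ) :
    lowerRight (binomMoment a b) = binomMoment (a + 1) b := by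
  ext c d
  rw [lowerRight_apply]
  cases d with
  | zero => simp [binomMoment, fallingQ_succ]
  | succ d =>
    rw [binomMoment, binomMoment, Finset.sum_range_succ' _ (d + 1), Finset.mul_sum]
    simp only [Nat.add_sub_cancel, Nat.cast_zero, fallingQ_succ, zero_mul, mul_zero, add_zero]
    refine Finset.sum_congr rfl fun j _ => ?_
    have h : ((d + 1 : ℕ) : ℚ) * (d.choose j : ℚ) =
        ((d + 1).choose (j + 1) : ℚ) * ((j + 1 : ℕ) : ℚ) := by
      exact_mod_cast Nat.add_one_mul_choose_eq d j
    rw [← mul_assoc, ← mul_assoc, h]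
    push_cast
    rw [add_sub_cancel_right, show c + ((d : ℚ) + 1) - (j + 1) = c + d - j by ring]
    ring

lemma add_binomMoment (a b : ℕ) :
    (lowerLeft + lowerRight) (binomMoment a b) = binomMoment a (b + 1) := by
  ext c d
  rw [LinearMap.add_apply, Pi.add_apply, Pi.add_apply, lowerLeft_apply, lowerRight_apply]
  have h_right : (d : ℚ) * binomMoment a b c (d - 1) = ∑ j ∈ Finset.range (d + 1),
      ((d : ℚ) - j) * (d.choose j : ℚ) * fallingQ j a * fallingQ (c + d - j - 1) b := by
    cases d with
    | zero => simp
    | succ d =>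
      rw [binomMoment, Finset.sum_range_succ _ (d + 1), Finset.mul_sum]
      simp only [Nat.add_sub_cancel, sub_self, zero_mul, add_zero]
      refine Finset.sum_congr rfl fun j hj => ?_
      have hj' : j ≤ d := Nat.lt_succ_iff.mp (Finset.mem_range.mp hj)
      have h : ((d + 1 : ℕ) : ℚ) * (d.choose j : ℚ) =
          (((d + 1 : ℕ) : ℚ) - j) * ((d + 1).choose j : ℚ) := by
        rw [← Nat.cast_sub (by omega)]
        exact_mod_cast (mul_comm _ _).trans ((Nat.choose_mul_succ_eq d j).trans (mul_comm _ _))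
      rw [← mul_assoc, ← mul_assoc, h]
      push_cast
      rw [show c + ((d : ℚ) + 1) - j - 1 = c + d - j by ring]
  rw [h_right, binomMoment, binomMoment, Finset.mul_sum, ← Finset.sum_add_distrib]
  refine Finset.sum_congr rfl fun j _ => ?_
  rw [fallingQ_succ, show c - 1 + (d : ℚ) - j = c + d - j - 1 by ring]
  ring

lemma pow_mul_pow_binomMoment (a b : ℕ) :
    (lowerRight ^ a * (lowerLeft + lowerRight) ^ b) (binomMoment 0 0) = binomMoment a b := by
  have h_add : ∀ b, ((lowerLeft + lowerRight) ^ b) (binomMoment 0 0) = binomMoment 0 b := by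
    intro b
    induction b with
    | zero => simp
    | succ b ih => rw [pow_succ', Module.End.mul_apply, ih, add_binomMoment]
  rw [Module.End.mul_apply, h_add]
  induction a with
  | zero => simp
  | succ a ih => rw [pow_succ', Module.End.mul_apply, ih, lowerRight_binomMoment]

lemma lowerLeft_pow_apply (r : ℕ) (f : ℚ → ℕ → ℚ) (c : ℚ) (d : ℕ) :
    (lowerLeft ^ r) f c d = fallingQ c r * f (c - r) d := by
  induction r generalizing c with
  | zero => simp [fallingQ_zero]
  | succ r ih =>
    rw [pow_succ', Module.End.mul_apply, lowerLeft_apply, ih, fallingQ_succ, mul_assoc]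
    push_cast
    rw [show c - 1 - (r : ℚ) = c - (r + 1) by ring]

lemma binomMoment_zero_zero (c : ℚ) (d : ℕ) : binomMoment 0 0 c d = 2 ^ d := by
  simp only [binomMoment, fallingQ_zero, mul_one]
  exact_mod_cast Nat.sum_range_choose d

lemma add_two_smul_pow_apply (r : ℕ) (c : ℚ) (d : ℕ) :
    ((lowerLeft + 2 • lowerRight) ^ r) (binomMoment 0 0) c d = fallingQ (c + d) r * 2 ^ d := by
  induction r generalizing c d with
  | zero => simp [fallingQ_zero, binomMoment_zero_zero]
  | succ r ih =>
    rw [pow_succ', Module.End.mul_apply, LinearMap.add_apply, LinearMap.smul_apply]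
    simp only [Pi.add_apply, Pi.smul_apply, lowerLeft_apply, lowerRight_apply, ih]
    rw [fallingQ_succ]
    cases d with
    | zero => simp
    | succ d =>
      simp only [Nat.add_sub_cancel, nsmul_eq_mul]
      push_cast
      rw [show c + ((d : ℚ) + 1) - 1 = c + d by ring, show c - 1 + ((d : ℚ) + 1) = c + d by ring]
      ring

lemma sub_sq_pow_apply (r : ℕ) :
    (((lowerLeft + lowerRight) ^ 2 - lowerRight ^ 2) ^ r) (binomMoment 0 0) =
      fun (c : ℚ) (d : ℕ) => fallingQ c r * (fallingQ (c - r + d) r * 2 ^ d) := by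
  have h_comm := commute_lowerLeft_lowerRight
  have h_factor : (lowerLeft + lowerRight) ^ 2 - lowerRight ^ 2 =
      lowerLeft * (lowerLeft + 2 • lowerRight) := by
    rw [sq, sq, add_mul, mul_add, mul_add, ← h_comm.eq, mul_add, mul_smul_comm, two_smul]
    abel
  ext c d
  rw [h_factor, ((Commute.refl _).add_right (h_comm.smul_right 2)).mul_pow, Module.End.mul_apply,
    lowerLeft_pow_apply, add_two_smul_pow_apply]

lemma sub_sq_pow_eq_sum (r : ℕ) (c : ℚ) (d : ℕ) :
    (((lowerLeft + lowerRight) ^ 2 - lowerRight ^ 2) ^ r) (binomMoment 0 0) c d =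
      ∑ h ∈ Finset.range (r + 1),
        (-1 : ℚ) ^ h * (r.choose h : ℚ) * binomMoment (2 * h) (2 * (r - h)) c d := by
  have h_comm : Commute (-lowerRight ^ 2) ((lowerLeft + lowerRight) ^ 2) :=
    ((commute_lowerLeft_lowerRight.symm.add_right (Commute.refl _)).pow_pow 2 2).neg_left
  rw [sub_eq_neg_add, h_comm.add_pow, LinearMap.sum_apply, Finset.sum_apply, Finset.sum_apply]
  refine Finset.sum_congr rfl fun h _ => ?_
  have h_term : (-lowerRight ^ 2) ^ h * ((lowerLeft + lowerRight) ^ 2) ^ (r - h) *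
      (r.choose h : Module.End ℚ (ℚ → ℕ → ℚ)) = ((-1 : ℚ) ^ h * (r.choose h : ℚ)) •
        (lowerRight ^ (2 * h) * (lowerLeft + lowerRight) ^ (2 * (r - h))) := by
    rw [neg_pow (lowerRight ^ 2), ← pow_mul, ← pow_mul, ← nsmul_eq_mul', mul_comm ((-1 : ℚ) ^ h), mul_smul,
      Nat.cast_smul_eq_nsmul, mul_assoc]
    rcases Nat.even_or_odd h with h_par | h_par <;> simp [h_par.neg_one_pow]
  rw [h_term, LinearMap.smul_apply, pow_mul_pow_binomMoment]
  rfl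

/-- `∑_{j=0}^{k} C(k,j) · α(r,t,j) = 2^k · r! · C(t,r) · C(t+r−k, r)`. -/
theorem sum_choose_alphaQ (k r t : ℕ) :
    ∑ j ∈ Finset.range (k + 1), (k.choose j : ℚ) * alphaQ r (t : ℚ) (j : ℚ) =
      2 ^ k * (r.factorial : ℚ) * gbinom (t : ℚ) r *
        gbinom ((t : ℚ) + (r : ℚ) - (k : ℚ)) r := by
  have h_alpha : ∀ j : ℕ, alphaQ r (t : ℚ) (j : ℚ) = (r.factorial : ℚ)⁻¹ *
      ∑ h ∈ Finset.range (r + 1), (-1 : ℚ) ^ h * (r.choose h : ℚ) *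
        (fallingQ j (2 * h) * fallingQ (((t : ℚ) + r - k) + k - j) (2 * (r - h))) := by
    intro j
    rw [alphaQ, Finset.mul_sum]
    refine Finset.sum_congr rfl fun h hh => ?_
    rw [gbinom_eq, gbinom_eq, Nat.cast_choose ℚ (Nat.lt_succ_iff.mp (Finset.mem_range.mp hh)),
      sub_add_cancel]
    have := Nat.factorial_ne_zero
    field_simp
  have h_main := congrFun₂ (sub_sq_pow_apply r) ((t : ℚ) + r - k) k
  rw [sub_sq_pow_eq_sum] at h_main
  simp only [h_alpha, Finset.mul_sum]
  rw [Finset.sum_comm]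
  simp only [binomMoment, Finset.mul_sum] at h_main
  have h_swap : ∀ h j : ℕ, (k.choose j : ℚ) * ((r.factorial : ℚ)⁻¹ *
      ((-1 : ℚ) ^ h * (r.choose h : ℚ) *
        (fallingQ j (2 * h) * fallingQ (((t : ℚ) + r - k) + k - j) (2 * (r - h))))) =
      (r.factorial : ℚ)⁻¹ * ((-1 : ℚ) ^ h * (r.choose h : ℚ) *
        ((k.choose j : ℚ) * fallingQ j (2 * h) *
          fallingQ (((t : ℚ) + r - k) + k - j) (2 * (r - h)))) := by
    intros; ring
  simp only [h_swap, ← Finset.mul_sum] at h_main ⊢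
  rw [h_main, gbinom_eq, gbinom_eq]
  have := Nat.factorial_ne_zero r
  rw [show (t : ℚ) + r - k - r + k = t by ring]
  field_simp
end

section
/- For every nonnegative integer r and all rational numbers a and b, ∑_{m=0}^{r} (−1)^m · ((2m)!·(2(r−m))!)/(m!·(r−m)!) · C(a, 2m) · C(b, 2(r−m)) = r! · C(a+b−r, r) · ∑_{m=0}^{r} (−1)^m · C(a,m) · C(b, r−m). (This is the coefficient form of the symmetric generating identity ∑_{r≥0} β(r,a,b)/(r!·C(a+b−r,r)) · z^r = (1−z)^a (1+z)^b, where β(r,a,b) denotes the left-hand side.) -/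
open Finset in
theorem factorial_mul_gbinom (x : ℚ) (m : ℕ) :
    (m.factorial : ℚ) * gbinom x m = ∏ i ∈ range m, (x - (i : ℚ)) :=
  mul_div_cancel₀ _ (Nat.cast_ne_zero.2 m.factorial_ne_zero)

/-- The shift `g ↦ g (i + 1, j)` on double sequences. -/
def shiftFst : Module.End ℚ (ℕ × ℕ → ℚ) :=
  LinearMap.funLeft ℚ ℚ fun p => (p.1 + 1, p.2)

/-- The shift `g ↦ g (i, j + 1)` on double sequences. -/
def shiftSnd : Module.End ℚ (ℕ × ℕ → ℚ) :=
  LinearMap.funLeft ℚ ℚ fun p => (p.1, p.2 + 1)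

theorem shiftFst_apply (g : ℕ × ℕ → ℚ) (i j : ℕ) : shiftFst g (i, j) = g (i + 1, j) := rfl

theorem shiftSnd_apply (g : ℕ × ℕ → ℚ) (i j : ℕ) : shiftSnd g (i, j) = g (i, j + 1) := rfl

theorem commute_shiftFst_shiftSnd : Commute shiftFst shiftSnd := rfl

theorem shiftFst_pow_apply (n : ℕ) (g : ℕ × ℕ → ℚ) (i j : ℕ) :
    (shiftFst ^ n) g (i, j) = g (i + n, j) := by
  induction n generalizing i with
  | zero => simp
  | succ n ih => rw [pow_succ', Module.End.mul_apply, shiftFst_apply, ih, add_right_comm, add_assoc]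

theorem shiftSnd_pow_apply (n : ℕ) (g : ℕ × ℕ → ℚ) (i j : ℕ) :
    (shiftSnd ^ n) g (i, j) = g (i, j + n) := by
  induction n generalizing j with
  | zero => simp
  | succ n ih => rw [pow_succ', Module.End.mul_apply, shiftSnd_apply, ih, add_right_comm, add_assoc]

open Finset in
theorem shiftSnd_pow_sub_shiftFst_pow_pow_apply_zero (s r : ℕ) (g : ℕ × ℕ → ℚ) :
    ((shiftSnd ^ s - shiftFst ^ s) ^ r) g (0, 0) =
      ∑ m ∈ range (r + 1), (-1 : ℚ) ^ m * (r.choose m : ℚ) * g (s * m, s * (r - m)) := by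
  have hc : Commute (-shiftFst ^ s) (shiftSnd ^ s) :=
    (commute_shiftFst_shiftSnd.pow_pow s s).neg_left
  rw [sub_eq_neg_add, hc.add_pow, LinearMap.sum_apply, Finset.sum_apply]
  refine sum_congr rfl fun m _ => ?_
  have hterm : (-shiftFst ^ s) ^ m * (shiftSnd ^ s) ^ (r - m) * (r.choose m : Module.End ℚ _) =
      ((-1 : ℚ) ^ m * (r.choose m : ℚ)) • (shiftFst ^ (s * m) * shiftSnd ^ (s * (r - m))) := by
    rw [← neg_one_smul ℚ, smul_pow, ← pow_mul, ← pow_mul, smul_mul_assoc, smul_mul_assoc,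
      mul_smul, ← nsmul_eq_mul', Nat.cast_smul_eq_nsmul]
  rw [hterm, LinearMap.smul_apply, Pi.smul_apply, Module.End.mul_apply, shiftFst_pow_apply,
    shiftSnd_pow_apply, zero_add, zero_add, smul_eq_mul]

open Finset in
/-- The double sequence of products of falling factorials of `a` and `b`. -/
def fallingProd (a b : ℚ) (p : ℕ × ℕ) : ℚ :=
  (∏ i ∈ range p.1, (a - (i : ℚ))) * ∏ j ∈ range p.2, (b - (j : ℚ))

open Finset in
theorem shiftSnd_add_shiftFst_pow_fallingProd (a b : ℚ) (r i j : ℕ) :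
    ((shiftSnd + shiftFst) ^ r) (fallingProd a b) (i, j) =
      (∏ k ∈ range r, (a + b - (i : ℚ) - (j : ℚ) - (k : ℚ))) * fallingProd a b (i, j) := by
  induction r generalizing i j with
  | zero => simp
  | succ r ih =>
    rw [pow_succ', Module.End.mul_apply, LinearMap.add_apply, Pi.add_apply, shiftSnd_apply,
      shiftFst_apply, ih, ih, prod_range_succ']
    have h₁ : ∀ k : ℕ, a + b - (i : ℚ) - ((j + 1 : ℕ) : ℚ) - (k : ℚ) =
        a + b - (i : ℚ) - (j : ℚ) - ((k + 1 : ℕ) : ℚ) := fun k => by push_cast; ring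
    have h₂ : ∀ k : ℕ, a + b - ((i + 1 : ℕ) : ℚ) - (j : ℚ) - (k : ℚ) =
        a + b - (i : ℚ) - (j : ℚ) - ((k + 1 : ℕ) : ℚ) := fun k => by push_cast; ring
    simp only [h₁, h₂, fallingProd, prod_range_succ]
    push_cast
    ring

theorem fallingProd_eq (a b : ℚ) (i j : ℕ) :
    fallingProd a b (i, j) = (i.factorial * gbinom a i) * (j.factorial * gbinom b j) := by
  rw [factorial_mul_gbinom, factorial_mul_gbinom, fallingProd]

open Finset in
theorem sum_choose_mul_fallingProd_two_mul (r : ℕ) (a b : ℚ) :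
    ∑ m ∈ range (r + 1), (-1 : ℚ) ^ m * (r.choose m : ℚ) * fallingProd a b (2 * m, 2 * (r - m)) =
      (∏ k ∈ range r, (a + b - (r : ℚ) - (k : ℚ))) *
        ∑ m ∈ range (r + 1), (-1 : ℚ) ^ m * (r.choose m : ℚ) * fallingProd a b (m, r - m) := by
  have hc : Commute shiftSnd shiftFst := commute_shiftFst_shiftSnd.symm
  have hcomm : Commute (shiftSnd + shiftFst) (shiftSnd - shiftFst) :=
    ((Commute.refl _).sub_right hc).add_left (hc.symm.sub_right (Commute.refl _))
  rw [← shiftSnd_pow_sub_shiftFst_pow_pow_apply_zero, hc.sq_sub_sq, hcomm.mul_pow,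
    (hcomm.pow_pow r r).eq, Module.End.mul_apply, ← pow_one shiftSnd, ← pow_one shiftFst]
  rw [shiftSnd_pow_sub_shiftFst_pow_pow_apply_zero, mul_sum]
  refine sum_congr rfl fun m hm => ?_
  have hle : m ≤ r := Nat.lt_succ_iff.1 (mem_range.1 hm)
  rw [pow_one, pow_one, one_mul, one_mul, shiftSnd_add_shiftFst_pow_fallingProd]
  have h : a + b - (m : ℚ) - ((r - m : ℕ) : ℚ) = a + b - (r : ℚ) := by
    rw [Nat.cast_sub hle]; ring
  rw [h]
  ring

/-- Coefficient form of the symmetric generating identity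
`∑_{r≥0} β(r,a,b)/(r!·C(a+b−r,r)) · z^r = (1−z)^a (1+z)^b`. -/
theorem beta_eq (r : ℕ) (a b : ℚ) :
    ∑ m ∈ Finset.range (r + 1),
        (-1 : ℚ) ^ m * (((2 * m).factorial : ℚ) * ((2 * (r - m)).factorial : ℚ)) /
            ((m.factorial : ℚ) * ((r - m).factorial : ℚ)) *
          gbinom a (2 * m) * gbinom b (2 * (r - m)) =
      (r.factorial : ℚ) * gbinom (a + b - (r : ℚ)) r *
        ∑ m ∈ Finset.range (r + 1), (-1 : ℚ) ^ m * gbinom a m * gbinom b (r - m) := by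
  have hr : (r.factorial : ℚ) ≠ 0 := Nat.cast_ne_zero.2 r.factorial_ne_zero
  apply mul_left_cancel₀ hr
  rw [factorial_mul_gbinom, mul_left_comm, Finset.mul_sum, Finset.mul_sum]
  refine Eq.trans (Finset.sum_congr rfl ?_)
    ((sum_choose_mul_fallingProd_two_mul r a b).trans
      (congrArg _ (Finset.sum_congr rfl ?_)))
  · intro m hm
    rw [fallingProd_eq, Nat.cast_choose ℚ (Nat.lt_succ_iff.1 (Finset.mem_range.1 hm))]
    ring
  · intro m hm
    rw [fallingProd_eq, Nat.cast_choose ℚ (Nat.lt_succ_iff.1 (Finset.mem_range.1 hm))]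
    have h₁ : (m.factorial : ℚ) ≠ 0 := Nat.cast_ne_zero.2 m.factorial_ne_zero
    have h₂ : ((r - m).factorial : ℚ) ≠ 0 := Nat.cast_ne_zero.2 (r - m).factorial_ne_zero
    field_simp
end

section
/- For all nonnegative integers k and t, ∑_{h=0}^{⌊k/2⌋} (k!/(h!·(k−2h)!)) · (−4)^{−h} · Γ(1/2 + t − h) = √π · t! · C(2t−k, t) · 2^{k−1−2t} · ε, where ε = 2 if k ≤ t and ε = 1 if k > t. In particular the sum vanishes whenever 0 < t < k ≤ 2t. -/
/-- The generalized binomial coefficient `C(x,m) = x(x-1)⋯(x-m+1)/m!` over ℝ. -/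
noncomputable def gbinomR (x : ℝ) (m : ℕ) : ℝ :=
  (∏ i ∈ Finset.range m, (x - (i : ℝ))) / (m.factorial : ℝ)

/-- The coefficient `k! / (h! (k - 2h)!) · (-4)⁻ʰ`, extended by zero to `2h > k`. -/
noncomputable def hermiteCoeff (k h : ℕ) : ℝ :=
  (k.choose (2 * h) : ℝ) * ((2 * h).factorial : ℝ) / (h.factorial : ℝ) / (-4) ^ h

theorem hermiteCoeff_zero_right (k : ℕ) : hermiteCoeff k 0 = 1 := by
  simp [hermiteCoeff]

theorem hermiteCoeff_eq_zero {k h : ℕ} (hk : k < 2 * h) : hermiteCoeff k h = 0 := by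
  simp [hermiteCoeff, Nat.choose_eq_zero_of_lt hk]

theorem hermiteCoeff_of_le {k h : ℕ} (hk : 2 * h ≤ k) :
    hermiteCoeff k h = (k.factorial : ℝ) / ((h.factorial : ℝ) * ((k - 2 * h).factorial : ℝ)) *
      (-4 : ℝ) ^ (-(h : ℤ)) := by
  have h1 : ((2 * h).factorial : ℝ) ≠ 0 := by positivity
  have h2 : ((k - 2 * h).factorial : ℝ) ≠ 0 := by positivity
  have h3 : (h.factorial : ℝ) ≠ 0 := by positivity
  rw [hermiteCoeff, Nat.cast_choose ℝ hk, zpow_neg, zpow_natCast]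
  field_simp

theorem hermiteCoeff_succ_succ (k h : ℕ) :
    hermiteCoeff (k + 2) (h + 1) =
      hermiteCoeff (k + 1) (h + 1) - ((k : ℝ) + 1) / 2 * hermiteCoeff k h := by
  have h3 : (h.factorial : ℝ) ≠ 0 := by positivity
  have h4 : (-4 : ℝ) ^ h ≠ 0 := by positivity
  have hc : ((k : ℝ) + 1) * (k.choose (2 * h) : ℝ) =
      ((k + 1).choose (2 * h + 1) : ℝ) * (2 * h + 1) := by
    exact_mod_cast Nat.add_one_mul_choose_eq k (2 * h)
  have hp : ((k + 2).choose (2 * h + 2) : ℝ) =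
      ((k + 1).choose (2 * h + 1) : ℝ) + ((k + 1).choose (2 * h + 2) : ℝ) := by
    exact_mod_cast Nat.choose_succ_succ (k + 1) (2 * h + 1)
  simp only [hermiteCoeff, show 2 * (h + 1) = 2 * h + 2 by ring, hp, Nat.factorial_succ, pow_succ]
  push_cast
  field_simp
  linear_combination (4 : ℝ) * (h + 1) * hc

/-- The sum of Gamma values with Hermite coefficients, truncated at `N` terms. -/
noncomputable def gammaSum (N k : ℕ) (x : ℝ) : ℝ :=
  ∑ h ∈ Finset.range N, hermiteCoeff k h * Real.Gamma (x - h)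

theorem gammaSum_succ_add_two (N k : ℕ) (x : ℝ) :
    gammaSum (N + 1) (k + 2) x =
      gammaSum (N + 1) (k + 1) x - ((k : ℝ) + 1) / 2 * gammaSum N k (x - 1) := by
  simp only [gammaSum, Finset.sum_range_succ', hermiteCoeff_zero_right, hermiteCoeff_succ_succ,
    Finset.mul_sum]
  rw [add_sub_right_comm, ← Finset.sum_sub_distrib]
  congr 1
  refine Finset.sum_congr rfl fun h _ => ?_
  rw [show x - 1 - (h : ℝ) = x - ((h + 1 : ℕ) : ℝ) by push_cast; ring]
  ring

theorem gammaSum_of_lt_two (N : ℕ) {k : ℕ} (hk : k < 2) (x : ℝ) :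
    gammaSum (N + 1) k x = Real.Gamma x := by
  rw [gammaSum, Finset.sum_range_succ', Finset.sum_eq_zero, hermiteCoeff_zero_right]
  · simp
  · intro h _
    rw [hermiteCoeff_eq_zero (by omega), zero_mul]

theorem gammaSum_eq (m : ℕ) : ∀ (N : ℕ) (x : ℝ), m < N → (∀ n : ℕ, x - (n + 1) ≠ 0) →
    gammaSum N (2 * m) x =
      Real.Gamma (x - m) * ∏ i ∈ Finset.range m, (x - 1 / 2 - m - i) ∧
    gammaSum N (2 * m + 1) x =
      Real.Gamma (x - m) * ∏ i ∈ Finset.range m, (x - 1 / 2 - m - 1 - i) := by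
  induction m with
  | zero =>
    intro N x hN _
    obtain ⟨N, rfl⟩ := Nat.exists_eq_add_of_lt hN
    simp [gammaSum_of_lt_two]
  | succ m ih =>
    intro N x hN hx
    obtain ⟨N, rfl⟩ : ∃ M, N = M + 1 := ⟨N - 1, by omega⟩
    have hx' : ∀ n : ℕ, x - 1 - (n + 1) ≠ 0 := fun n hn =>
      hx (n + 1) (by push_cast; linarith)
    have hG : Real.Gamma (x - m) = (x - 1 - m) * Real.Gamma (x - 1 - m) := by
      rw [← Real.Gamma_add_one (by have := hx m; contrapose! this; linarith)]
      congr 1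
      ring
    have heven : gammaSum (N + 1) (2 * (m + 1)) x = Real.Gamma (x - 1 - m) *
        ∏ i ∈ Finset.range (m + 1), (x - 1 / 2 - m - 1 - i) := by
      rw [show 2 * (m + 1) = 2 * m + 2 by ring, gammaSum_succ_add_two,
        (ih (N + 1) x (by omega) hx).2, (ih N (x - 1) (by omega) hx').1, hG,
        Finset.prod_range_succ,
        Finset.prod_congr rfl fun (i : ℕ) _ =>
          show x - 1 - 1 / 2 - (m : ℝ) - i = x - 1 / 2 - m - 1 - i by ring]
      push_cast
      ring
    have hxm : x - ((m + 1 : ℕ) : ℝ) = x - 1 - m := by push_cast; ring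
    refine ⟨?_, ?_⟩
    · rw [heven, hxm]
      congr 1
      refine Finset.prod_congr rfl fun i _ => ?_
      push_cast
      ring
    · rw [show 2 * (m + 1) + 1 = (2 * m + 1) + 2 by ring, gammaSum_succ_add_two,
        show 2 * m + 1 + 1 = 2 * (m + 1) by ring, heven,
        (ih N (x - 1) (by omega) hx').2, hxm, Finset.prod_range_succ',
        Finset.prod_range_succ,
        Finset.prod_congr rfl fun (i : ℕ) _ =>
          show x - 1 / 2 - (m : ℝ) - 1 - ((i + 1 : ℕ) : ℝ) = x - 1 / 2 - m - 2 - i by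
            push_cast; ring,
        Finset.prod_congr rfl fun (i : ℕ) _ =>
          show x - 1 - 1 / 2 - (m : ℝ) - 1 - i = x - 1 / 2 - m - 2 - i by ring,
        Finset.prod_congr rfl fun (i : ℕ) _ =>
          show x - 1 / 2 - ((m + 1 : ℕ) : ℝ) - 1 - i = x - 1 / 2 - m - 2 - i by
            push_cast; ring]
      push_cast
      ring

theorem prod_range_natCast_sub (d m : ℕ) :
    ∏ i ∈ Finset.range m, (((d + m : ℕ) : ℝ) - i) =
      ((d + m).factorial : ℝ) / (d.factorial : ℝ) := by
  rw [eq_div_iff (by positivity)]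
  induction m with
  | zero => simp
  | succ m ih =>
    rw [Finset.prod_range_succ', ← add_assoc, Nat.factorial_succ]
    push_cast at ih ⊢
    simp only [add_sub_add_right_eq_sub]
    linear_combination ((d : ℝ) + m + 1) * ih

theorem prod_range_neg_sub (p m : ℕ) :
    ∏ i ∈ Finset.range m, (-((p : ℝ) + 1) - i) =
      (-1) ^ m * ((p + m).factorial : ℝ) / (p.factorial : ℝ) := by
  rw [eq_div_iff (by positivity)]
  induction m with
  | zero => simp
  | succ m ih =>
    rw [Finset.prod_range_succ, ← add_assoc, Nat.factorial_succ]
    push_cast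
    linear_combination (-((p : ℝ) + 1) - m) * ih

theorem prod_range_natCast_sub_eq_zero {a m : ℕ} (h : a < m) :
    ∏ i ∈ Finset.range m, ((a : ℝ) - i) = 0 :=
  Finset.prod_eq_zero (Finset.mem_range.2 h) (sub_self _)

theorem Real.Gamma_natCast_add_half_eq_factorial (n : ℕ) :
    Real.Gamma ((n : ℝ) + 1 / 2) =
      Real.sqrt Real.pi * ((2 * n).factorial : ℝ) / (2 ^ (2 * n) * (n.factorial : ℝ)) := by
  rw [eq_div_iff (by positivity)]
  induction n with
  | zero => simpa using Real.Gamma_one_half_eq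
  | succ n ih =>
    rw [show ((n + 1 : ℕ) : ℝ) + 1 / 2 = (n + 1 / 2) + 1 by push_cast; ring,
      Real.Gamma_add_one (by positivity), show 2 * (n + 1) = 2 * n + 1 + 1 by ring]
    simp only [Nat.factorial_succ, pow_succ]
    push_cast
    linear_combination (2 * ((n : ℝ) + 1)) * (2 * n + 1) * ih

theorem Real.Gamma_half_sub_natCast (p : ℕ) :
    Real.Gamma (1 / 2 - (p : ℝ)) =
      Real.sqrt Real.pi * ((-1) ^ p * 2 ^ (2 * p)) * (p.factorial : ℝ) /
        ((2 * p).factorial : ℝ) := by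
  rw [eq_div_iff (by positivity)]
  induction p with
  | zero => simpa using Real.Gamma_one_half_eq
  | succ p ih =>
    have hne : (1 / 2 - ((p + 1 : ℕ) : ℝ)) ≠ 0 := by
      push_cast
      have : (0 : ℝ) ≤ p := by positivity
      linarith
    have h := Real.Gamma_add_one hne
    rw [show (1 / 2 - ((p + 1 : ℕ) : ℝ)) + 1 = 1 / 2 - p by push_cast; ring] at h
    rw [h] at ih
    rw [show 2 * (p + 1) = 2 * p + 1 + 1 by ring]
    simp only [Nat.factorial_succ, pow_succ]
    push_cast at ih ⊢
    linear_combination (-4 * ((p : ℝ) + 1)) * ih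

theorem gamma_mul_prod_even (m t : ℕ) :
    Real.Gamma (1 / 2 + (t : ℝ) - m) *
        ∏ i ∈ Finset.range m, (1 / 2 + (t : ℝ) - 1 / 2 - m - i) =
      Real.sqrt Real.pi * (∏ i ∈ Finset.range t, ((2 * t : ℝ) - ((2 * m : ℕ) : ℝ) - i)) *
        (2 : ℝ) ^ (((2 * m : ℕ) : ℤ) - 1 - 2 * (t : ℤ)) * (if 2 * m ≤ t then 2 else 1) := by
  rcases le_or_gt m t with hmt | hmt
  · obtain ⟨n, rfl⟩ := Nat.exists_eq_add_of_le hmt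
    rw [Finset.prod_congr rfl fun (i : ℕ) _ =>
        show 1 / 2 + ((m + n : ℕ) : ℝ) - 1 / 2 - m - i = (n : ℝ) - i by push_cast; ring,
      Finset.prod_congr rfl fun (i : ℕ) _ =>
        show (2 * (m + n : ℕ) : ℝ) - ((2 * m : ℕ) : ℝ) - i = ((2 * n : ℕ) : ℝ) - i by
          push_cast; ring]
    rcases le_or_gt m n with hmn | hmn
    · obtain ⟨d, rfl⟩ := Nat.exists_eq_add_of_le' hmn
      rw [if_pos (by omega), prod_range_natCast_sub,
        show 2 * (d + m) = d + (m + (d + m)) by ring, prod_range_natCast_sub,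
        show 1 / 2 + ((m + (d + m) : ℕ) : ℝ) - m = ((d + m : ℕ) : ℝ) + 1 / 2 by
          push_cast; ring, Real.Gamma_natCast_add_half_eq_factorial,
        show ((2 * m : ℕ) : ℤ) - 1 - 2 * ((m + (d + m) : ℕ) : ℤ) =
          -((2 * (d + m) + 1 : ℕ) : ℤ) by push_cast; ring, zpow_neg, zpow_natCast,
        show d + (m + (d + m)) = 2 * (d + m) by ring, pow_succ]
      have := Nat.factorial_ne_zero (d + m)
      field_simp
    · rw [prod_range_natCast_sub_eq_zero hmn, prod_range_natCast_sub_eq_zero (by omega)]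
      simp
  · obtain ⟨q, rfl⟩ := Nat.exists_eq_add_of_lt hmt
    rw [Finset.prod_congr rfl fun (i : ℕ) _ =>
        show 1 / 2 + (t : ℝ) - 1 / 2 - ((t + q + 1 : ℕ) : ℝ) - i = -((q : ℝ) + 1) - i by
          push_cast; ring,
      Finset.prod_congr rfl fun (i : ℕ) _ =>
        show (2 * t : ℝ) - ((2 * (t + q + 1) : ℕ) : ℝ) - i =
          -(((2 * q + 1 : ℕ) : ℝ) + 1) - i by push_cast; ring,
      prod_range_neg_sub, prod_range_neg_sub, if_neg (by omega),
      show 1 / 2 + (t : ℝ) - ((t + q + 1 : ℕ) : ℝ) = 1 / 2 - ((q + 1 : ℕ) : ℝ) by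
        push_cast; ring, Real.Gamma_half_sub_natCast,
      show ((2 * (t + q + 1) : ℕ) : ℤ) - 1 - 2 * (t : ℤ) = ((2 * q + 1 : ℕ) : ℤ) by
        push_cast; ring, zpow_natCast,
      show q + (t + q + 1) = 2 * q + 1 + t by ring,
      show 2 * (q + 1) = 2 * q + 1 + 1 by ring, Nat.factorial_succ (2 * q + 1),
      Nat.factorial_succ q, show t + q + 1 = t + (q + 1) by ring, pow_add (-1 : ℝ) t]
    have hs : ((-1 : ℝ) ^ (q + 1)) * (-1) ^ (q + 1) = 1 := by
      rw [← mul_pow]; simp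
    push_cast
    have hq : (2 * (q : ℝ) + 1 + 1) ≠ 0 := by positivity
    have := Nat.factorial_ne_zero (2 * q + 1)
    field_simp
    rw [pow_succ (2 : ℝ) (2 * q + 1)]
    linear_combination (2 * ((q : ℝ) + 1) * 2 ^ (2 * q + 1)) * hs

theorem gamma_mul_prod_odd (m t : ℕ) :
    Real.Gamma (1 / 2 + (t : ℝ) - m) *
        ∏ i ∈ Finset.range m, (1 / 2 + (t : ℝ) - 1 / 2 - m - 1 - i) =
      Real.sqrt Real.pi *
        (∏ i ∈ Finset.range t, ((2 * t : ℝ) - ((2 * m + 1 : ℕ) : ℝ) - i)) *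
        (2 : ℝ) ^ (((2 * m + 1 : ℕ) : ℤ) - 1 - 2 * (t : ℤ)) *
        (if 2 * m + 1 ≤ t then 2 else 1) := by
  rcases lt_or_ge m t with hmt | hmt
  · obtain ⟨n, rfl⟩ := Nat.exists_eq_add_of_lt hmt
    rw [Finset.prod_congr rfl fun (i : ℕ) _ =>
        show 1 / 2 + ((m + n + 1 : ℕ) : ℝ) - 1 / 2 - m - 1 - i = (n : ℝ) - i by
          push_cast; ring,
      Finset.prod_congr rfl fun (i : ℕ) _ =>
        show (2 * (m + n + 1 : ℕ) : ℝ) - ((2 * m + 1 : ℕ) : ℝ) - i =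
          ((2 * n + 1 : ℕ) : ℝ) - i by push_cast; ring]
    rcases le_or_gt m n with hmn | hmn
    · obtain ⟨d, rfl⟩ := Nat.exists_eq_add_of_le' hmn
      rw [if_pos (by omega), prod_range_natCast_sub,
        show 2 * (d + m) + 1 = d + (m + (d + m) + 1) by ring, prod_range_natCast_sub,
        show 1 / 2 + ((m + (d + m) + 1 : ℕ) : ℝ) - m = ((d + m + 1 : ℕ) : ℝ) + 1 / 2 by
          push_cast; ring, Real.Gamma_natCast_add_half_eq_factorial,
        show ((2 * m + 1 : ℕ) : ℤ) - 1 - 2 * ((m + (d + m) + 1 : ℕ) : ℤ) =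
          -((2 * (d + m + 1) : ℕ) : ℤ) by push_cast; ring, zpow_neg, zpow_natCast,
        show d + (m + (d + m) + 1) = 2 * (d + m) + 1 by ring,
        show (2 * (d + m + 1)).factorial = (2 * (d + m) + 1 + 1).factorial from rfl,
        Nat.factorial_succ (2 * (d + m) + 1), Nat.factorial_succ (d + m)]
      have := Nat.factorial_ne_zero (d + m)
      have hq : ((d : ℝ) + m + 1) ≠ 0 := by positivity
      push_cast
      field_simp
      ring
    · rw [prod_range_natCast_sub_eq_zero hmn, prod_range_natCast_sub_eq_zero (by omega)]
      simp
  · obtain ⟨p, rfl⟩ := Nat.exists_eq_add_of_le hmt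
    rw [Finset.prod_congr rfl fun (i : ℕ) _ =>
        show 1 / 2 + (t : ℝ) - 1 / 2 - ((t + p : ℕ) : ℝ) - 1 - i = -((p : ℝ) + 1) - i by
          push_cast; ring,
      Finset.prod_congr rfl fun (i : ℕ) _ =>
        show (2 * t : ℝ) - ((2 * (t + p) + 1 : ℕ) : ℝ) - i =
          -(((2 * p : ℕ) : ℝ) + 1) - i by push_cast; ring,
      prod_range_neg_sub, prod_range_neg_sub, if_neg (by omega),
      show 1 / 2 + (t : ℝ) - ((t + p : ℕ) : ℝ) = 1 / 2 - (p : ℝ) by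
        push_cast; ring, Real.Gamma_half_sub_natCast,
      show ((2 * (t + p) + 1 : ℕ) : ℤ) - 1 - 2 * (t : ℤ) = ((2 * p : ℕ) : ℤ) by
        push_cast; ring, zpow_natCast,
      show p + (t + p) = 2 * p + t by ring, pow_add (-1 : ℝ) t]
    have hs : ((-1 : ℝ) ^ p) * (-1) ^ p = 1 := by
      rw [← mul_pow]; simp
    have := Nat.factorial_ne_zero (2 * p)
    field_simp
    linear_combination hs

theorem half_add_natCast_sub_ne_zero (t n : ℕ) : 1 / 2 + (t : ℝ) - (n + 1) ≠ 0 := by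
  intro h
  have h2 : (2 * t : ℝ) = 2 * n + 1 := by linarith
  have h3 : 2 * t = 2 * n + 1 := by exact_mod_cast h2
  omega

/-- `∑_{h=0}^{⌊k/2⌋} (k!/(h!(k−2h)!))·(−4)^{−h}·Γ(1/2+t−h)
  = √π·t!·C(2t−k,t)·2^{k−1−2t}·(2 if k ≤ t else 1)`;
in particular the sum vanishes whenever `0 < t < k ≤ 2t`. -/
theorem gamma_sum_eval (k t : ℕ) :
    (∑ h ∈ Finset.range (k / 2 + 1),
        (k.factorial : ℝ) / ((h.factorial : ℝ) * ((k - 2 * h).factorial : ℝ)) *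
          (-4 : ℝ) ^ (-(h : ℤ)) * Real.Gamma (1 / 2 + (t : ℝ) - (h : ℝ)) =
      Real.sqrt Real.pi * (t.factorial : ℝ) * gbinomR ((2 * t : ℝ) - (k : ℝ)) t *
        (2 : ℝ) ^ ((k : ℤ) - 1 - 2 * (t : ℤ)) * (if k ≤ t then 2 else 1)) ∧
    (0 < t → t < k → k ≤ 2 * t →
      ∑ h ∈ Finset.range (k / 2 + 1),
          (k.factorial : ℝ) / ((h.factorial : ℝ) * ((k - 2 * h).factorial : ℝ)) *
            (-4 : ℝ) ^ (-(h : ℤ)) * Real.Gamma (1 / 2 + (t : ℝ) - (h : ℝ)) = 0) := by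
  have main : ∑ h ∈ Finset.range (k / 2 + 1),
        (k.factorial : ℝ) / ((h.factorial : ℝ) * ((k - 2 * h).factorial : ℝ)) *
          (-4 : ℝ) ^ (-(h : ℤ)) * Real.Gamma (1 / 2 + (t : ℝ) - (h : ℝ)) =
      Real.sqrt Real.pi * (t.factorial : ℝ) * gbinomR ((2 * t : ℝ) - (k : ℝ)) t *
        (2 : ℝ) ^ ((k : ℤ) - 1 - 2 * (t : ℤ)) * (if k ≤ t then 2 else 1) := by
    have hsum : ∑ h ∈ Finset.range (k / 2 + 1),
        (k.factorial : ℝ) / ((h.factorial : ℝ) * ((k - 2 * h).factorial : ℝ)) *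
          (-4 : ℝ) ^ (-(h : ℤ)) * Real.Gamma (1 / 2 + (t : ℝ) - (h : ℝ)) =
        gammaSum (k / 2 + 1) k (1 / 2 + t) := by
      refine Finset.sum_congr rfl fun h hh => ?_
      rw [Finset.mem_range] at hh
      rw [hermiteCoeff_of_le (by omega)]
    have hbin : (t.factorial : ℝ) * gbinomR ((2 * t : ℝ) - (k : ℝ)) t =
        ∏ i ∈ Finset.range t, ((2 * t : ℝ) - (k : ℝ) - i) :=
      mul_div_cancel₀ _ (by positivity)
    rw [hsum, mul_assoc (Real.sqrt Real.pi), hbin]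
    have hx := half_add_natCast_sub_ne_zero t
    obtain ⟨m, rfl | rfl⟩ := Nat.even_or_odd' k
    · rw [(gammaSum_eq m _ _ (by omega) hx).1, gamma_mul_prod_even]
    · rw [(gammaSum_eq m _ _ (by omega) hx).2, gamma_mul_prod_odd]
  refine ⟨main, fun _ htk hk => ?_⟩
  rw [main, gbinomR, ← Nat.cast_ofNat (R := ℝ) (n := 2), ← Nat.cast_mul, ← Nat.cast_sub hk,
    prod_range_natCast_sub_eq_zero (by omega)]
  simp
end

section
/- Let N ≥ 1 be an integer, let g be a real symmetric invertible N×N matrix with inverse g⁻¹, and let Z ∈ ℂ^N satisfy ∑_{i,j} Z_i g_{ij} Z_j = 0 and c := ∑_{i,j} Z_i g_{ij} conj(Z_j) ≠ 0. For a nonnegative integer k define f : ℝ^N → ℂ by f(x) = (∑_{i,j} x_i g_{ij} Z_j)^k · exp( π·∑_{i,j} x_i g_{ij} x_j − (4π/c)·(∑_{i,j} x_i g_{ij} Z_j)·(∑_{i,j} x_i g_{ij} conj(Z_j)) ). Then f is smooth and satisfies Vignéras' differential equation with weight κ = k + 2 − N/2: for every x ∈ ℝ^N, (1/2)·∑_{i,j}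 (g⁻¹)_{ij} · ∂²f/∂x_i∂x_j (x) = 2π²·(∑_{i,j} x_i g_{ij} x_j)·f(x) − 2π·κ·f(x). -/
open Matrix

section GaussianTimesPower

variable {V : Type*} [NormedAddCommGroup V] [NormedSpace ℝ V]

/-- The function `L ^ k * exp (A y y / 2)` for a linear form `L` and a bilinear form `A`. -/
noncomputable def powMulExp (L : V →L[ℝ] ℂ) (A : V →L[ℝ] V →L[ℝ] ℂ) (k : ℕ) (y : V) : ℂ :=
  L y ^ k * Complex.exp (A y y / 2)

variable (L : V →L[ℝ] ℂ) (A : V →L[ℝ] V →L[ℝ] ℂ) (k : ℕ)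

theorem contDiff_powMulExp {n : WithTop ℕ∞} : ContDiff ℝ n (powMulExp L A k) := by
  unfold powMulExp
  exact (L.contDiff.pow k).mul
    (Complex.contDiff_exp.comp ((A.contDiff.clm_apply contDiff_id).div_const 2))

variable {A}

theorem hasLineDerivAt_exp_half_bilin (hA : ∀ v w, A v w = A w v) (y v : V) :
    HasLineDerivAt ℝ (fun y => Complex.exp (A y y / 2)) (Complex.exp (A y y / 2) * A y v) y v := by
  have hl : HasDerivAt (fun t : ℝ => y + t • v) v 0 := by
    simpa using ((hasDerivAt_id (0 : ℝ)).smul_const v).const_add y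
  have h := (((A.hasFDerivAt.comp_hasDerivAt (0 : ℝ) hl).clm_apply hl).div_const 2).cexp
  refine h.congr_deriv ?_
  simp [hA v y]

theorem hasLineDerivAt_pow_clm (y v : V) :
    HasLineDerivAt ℝ (fun y => L y ^ k) (k * L y ^ (k - 1) * L v) y v := by
  have hl : HasDerivAt (fun t : ℝ => y + t • v) v 0 := by
    simpa using ((hasDerivAt_id (0 : ℝ)).smul_const v).const_add y
  refine ((L.hasFDerivAt.comp_hasDerivAt (0 : ℝ) hl).pow k).congr_deriv ?_
  simp

theorem fderiv_powMulExp (hA : ∀ v w, A v w = A w v) (y v : V) :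
    fderiv ℝ (powMulExp L A k) y v =
      k * L v * powMulExp L A (k - 1) y + powMulExp L A k y * A y v := by
  have hd : DifferentiableAt ℝ (powMulExp L A k) y :=
    (contDiff_powMulExp L A k (n := 1)).differentiable one_ne_zero y
  rw [← hd.lineDeriv_eq_fderiv]
  have h := HasDerivAt.mul (hasLineDerivAt_pow_clm L k y v) (hasLineDerivAt_exp_half_bilin hA y v)
  refine (HasLineDerivAt.lineDeriv (f := powMulExp L A k) h).trans ?_
  simp only [powMulExp, zero_smul, add_zero]
  ring

theorem fderiv_fderiv_powMulExp (hA : ∀ v w, A v w = A w v) (x v w : V) :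
    fderiv ℝ (fun y => fderiv ℝ (powMulExp L A k) y v) x w =
      k * L v * ((k - 1 : ℕ) * L w * powMulExp L A (k - 1 - 1) x +
          powMulExp L A (k - 1) x * A x w) +
        (powMulExp L A k x * A w v +
          (k * L w * powMulExp L A (k - 1) x + powMulExp L A k x * A x w) * A x v) := by
  have hd (m : ℕ) : HasFDerivAt (powMulExp L A m) (fderiv ℝ (powMulExp L A m) x) x :=
    ((contDiff_powMulExp L A m (n := 1)).differentiable one_ne_zero x).hasFDerivAt
  simp_rw [fderiv_powMulExp L k hA]
  have h := ((hd (k - 1)).const_mul (k * L v)).add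
    ((hd k).mul (A.flip v).hasFDerivAt)
  have e := congrArg (fun T => T w) h.fderiv
  refine e.trans ?_
  simp [fderiv_powMulExp L _ hA]
  ring

end GaussianTimesPower

section RealPoints

theorem ofReal_single_one {ι : Type*} [DecidableEq ι] (i : ι) :
    (fun l => ((Pi.single i (1 : ℝ) : ι → ℝ) l : ℂ)) = Pi.single i 1 := by
  ext l
  by_cases h : l = i <;> simp [h]

variable {ι : Type*} [Fintype ι]

/-- The real-linear form `x ↦ ∑ i, u i * x i` on real vectors with complex coefficients `u`. -/
noncomputable def complexForm (u : ι → ℂ) : (ι → ℝ) →L[ℝ] ℂ :=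
  ∑ i, u i • Complex.ofRealCLM.comp (ContinuousLinearMap.proj i)

theorem complexForm_apply (u : ι → ℂ) (x : ι → ℝ) :
    complexForm u x = (fun i => (x i : ℂ)) ⬝ᵥ u := by
  simp [complexForm, dotProduct, mul_comm]

/-- The real-bilinear form on real vectors with complex Gram matrix `S`. -/
noncomputable def complexBilin (S : Matrix ι ι ℂ) : (ι → ℝ) →L[ℝ] (ι → ℝ) →L[ℝ] ℂ :=
  ∑ i, ∑ j, S i j • (ContinuousLinearMap.mul ℝ ℂ).bilinearComp
    (Complex.ofRealCLM.comp (ContinuousLinearMap.proj i))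
    (Complex.ofRealCLM.comp (ContinuousLinearMap.proj j))

theorem complexBilin_apply (S : Matrix ι ι ℂ) (x y : ι → ℝ) :
    complexBilin S x y = (fun i => (x i : ℂ)) ⬝ᵥ S *ᵥ fun i => (y i : ℂ) := by
  simp only [complexBilin, _root_.sum_apply, _root_.smul_apply,
    ContinuousLinearMap.bilinearComp_apply, ContinuousLinearMap.mul_apply', dotProduct, mulVec,
    Finset.mul_sum, smul_eq_mul]
  refine Finset.sum_congr rfl fun i _ => Finset.sum_congr rfl fun j _ => ?_
  simp
  ring

variable [DecidableEq ι]

theorem sum_mul_fderiv_fderiv_powMulExp (H S : Matrix ι ι ℂ) (hS : S.IsSymm) (u : ι → ℂ) (k : ℕ)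
    (hu : u ⬝ᵥ H *ᵥ u = 0) (hH : H.IsSymm) (x : ι → ℝ) :
    ∑ i, ∑ j, H i j * fderiv ℝ (fun y : ι → ℝ =>
        fderiv ℝ (powMulExp (complexForm u) (complexBilin S) k) y (Pi.single j 1)) x
          (Pi.single i 1) =
      2 * k * (u ⬝ᵥ H *ᵥ (S *ᵥ fun i => (x i : ℂ))) *
          powMulExp (complexForm u) (complexBilin S) (k - 1) x +
        ((S *ᵥ fun i => (x i : ℂ)) ⬝ᵥ H *ᵥ (S *ᵥ fun i => (x i : ℂ)) + (H * S).trace) *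
          powMulExp (complexForm u) (complexBilin S) k x := by
  have hA (v w : ι → ℝ) : complexBilin S v w = complexBilin S w v := by
    rw [complexBilin_apply, complexBilin_apply, dotProduct_mulVec, dotProduct_comm,
      ← mulVec_transpose, hS.eq]
  set X : ι → ℂ := fun i => (x i : ℂ) with hX
  set p := S *ᵥ X with hp
  have hLi (i : ι) : complexForm u (Pi.single i 1) = u i := by
    rw [complexForm_apply, ofReal_single_one]; simp
  have hAx (i : ι) : complexBilin S x (Pi.single i 1) = p i := by
    rw [hA, complexBilin_apply, ofReal_single_one]; simp [hp, hX]
  have hAij (i j : ι) : complexBilin S (Pi.single i 1) (Pi.single j 1) = S j i := by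
    rw [complexBilin_apply, ofReal_single_one, ofReal_single_one]
    simp [hS.apply]
  have hB (a b : ι → ℂ) : a ⬝ᵥ H *ᵥ b = ∑ i, ∑ j, H i j * (a i * b j) := by
    simp only [dotProduct, mulVec, Finset.mul_sum]
    exact Finset.sum_congr rfl fun i _ => Finset.sum_congr rfl fun j _ => by ring
  have hsw : p ⬝ᵥ H *ᵥ u = u ⬝ᵥ H *ᵥ p := by
    rw [dotProduct_mulVec, dotProduct_comm, ← mulVec_transpose, hH.eq]
  have htr : (H * S).trace = ∑ i, ∑ j, H i j * S j i := by
    simp [trace, mul_apply]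
  simp_rw [fderiv_fderiv_powMulExp _ _ hA, hLi, hAx, hAij]
  set F := powMulExp (complexForm u) (complexBilin S)
  calc _ = (k * (k - 1 : ℕ) * F (k - 1 - 1) x) * (u ⬝ᵥ H *ᵥ u)
        + k * F (k - 1) x * (p ⬝ᵥ H *ᵥ u) + k * F (k - 1) x * (u ⬝ᵥ H *ᵥ p)
        + F k x * (p ⬝ᵥ H *ᵥ p) + F k x * (H * S).trace := by
        simp only [hB, htr, Finset.mul_sum, ← Finset.sum_add_distrib]
        exact Finset.sum_congr rfl fun i _ => Finset.sum_congr rfl fun j _ => by ring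
    _ = _ := by rw [hu, hsw]; ring

end RealPoints

/-- Vignéras' differential equation for the Schwartz-like function
`f(x) = ⟨x,Z⟩^k · exp(π⟨x,x⟩ − (4π/c)·⟨x,Z⟩·⟨x, conj Z⟩)` attached to a point `Z`
of the affine cone (`⟨Z,Z⟩ = 0`, `c = ⟨Z, conj Z⟩ ≠ 0`), with weight `κ = k + 2 − N/2`. -/
theorem vigneras_equation (N : ℕ) (hN : 1 ≤ N)
    (g ginv : Matrix (Fin N) (Fin N) ℝ) (hsymm : g.IsSymm)
    (hinv : g * ginv = 1) (hinv' : ginv * g = 1)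
    (Z : Fin N → ℂ)
    (hZZ : ∑ i, ∑ j, Z i * (g i j : ℂ) * Z j = 0)
    (c : ℂ) (hc : c = ∑ i, ∑ j, Z i * (g i j : ℂ) * (starRingEnd ℂ) (Z j))
    (hc0 : c ≠ 0)
    (k : ℕ)
    (f : (Fin N → ℝ) → ℂ)
    (hf : ∀ x : Fin N → ℝ,
      f x = (∑ i, ∑ j, (x i : ℂ) * (g i j : ℂ) * Z j) ^ k *
        Complex.exp ((Real.pi : ℂ) * (∑ i, ∑ j, (x i : ℂ) * (g i j : ℂ) * (x j : ℂ)) -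
          (4 * (Real.pi : ℂ) / c) * (∑ i, ∑ j, (x i : ℂ) * (g i j : ℂ) * Z j) *
            (∑ i, ∑ j, (x i : ℂ) * (g i j : ℂ) * (starRingEnd ℂ) (Z j)))) :
    ContDiff ℝ (⊤ : ℕ∞) f ∧
      ∀ x : Fin N → ℝ,
        (1 / 2 : ℂ) * ∑ i, ∑ j, (ginv i j : ℂ) *
            fderiv ℝ (fun y : Fin N → ℝ => fderiv ℝ f y (Pi.single j 1)) x (Pi.single i 1) =
          2 * (Real.pi : ℂ) ^ 2 * (∑ i, ∑ j, (x i : ℂ) * (g i j : ℂ) * (x j : ℂ)) * f x -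
            2 * (Real.pi : ℂ) * ((k : ℂ) + 2 - (N : ℂ) / 2) * f x := by
  set G : Matrix (Fin N) (Fin N) ℂ := g.map Complex.ofReal with hG
  set H : Matrix (Fin N) (Fin N) ℂ := ginv.map Complex.ofReal with hH
  set W : Fin N → ℂ := fun j => (starRingEnd ℂ) (Z j) with hW
  have hsum (a b : Fin N → ℂ) : ∑ i, ∑ j, a i * (g i j : ℂ) * b j = a ⬝ᵥ G *ᵥ b := by
    simp [dotProduct, mulVec, Finset.mul_sum, hG, mul_assoc]
  have hGsymm : G.IsSymm := hsymm.map _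
  have hHG : H * G = 1 := by
    have := congrArg (fun T => T.map Complex.ofRealHom) hinv'
    rwa [Matrix.map_mul, Matrix.map_one _ (map_zero _) (map_one _)] at this
  have hGH : G * H = 1 := mul_eq_one_comm.mp hHG
  have hHsymm : H.IsSymm := by
    have h : Hᵀ * G = 1 := by
      rw [← transpose_one, ← hGH, transpose_mul, hGsymm.eq]
    exact left_inv_eq_right_inv h hGH
  have hcomm (a b : Fin N → ℂ) : a ⬝ᵥ G *ᵥ b = b ⬝ᵥ G *ᵥ a := by
    rw [dotProduct_mulVec, dotProduct_comm, ← mulVec_transpose, hGsymm.eq]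
  have hdual (a b : Fin N → ℂ) : (G *ᵥ a) ⬝ᵥ H *ᵥ (G *ᵥ b) = a ⬝ᵥ G *ᵥ b := by
    rw [mulVec_mulVec, hHG, one_mulVec, dotProduct_comm, hcomm]
  have hZZ' : Z ⬝ᵥ G *ᵥ Z = 0 := by rw [← hsum]; exact hZZ
  have hZW : Z ⬝ᵥ G *ᵥ W = c := by rw [← hsum, hc]
  have hWW : W ⬝ᵥ G *ᵥ W = 0 := by
    have := congrArg (starRingEnd ℂ) hZZ
    rw [← hsum]
    simpa [hW] using this
  set a : ℂ := 4 * Real.pi / c with ha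
  set u := G *ᵥ Z with hu
  set v := G *ᵥ W with hv
  set S : Matrix (Fin N) (Fin N) ℂ :=
    (2 * Real.pi : ℂ) • G - a • (vecMulVec u v + vecMulVec v u) with hS
  have hSsymm : S.IsSymm := by
    simp [Matrix.IsSymm, hS, hGsymm.eq, transpose_vecMulVec, add_comm]
  have hSmul (X : Fin N → ℂ) : S *ᵥ X =
      G *ᵥ ((2 * Real.pi : ℂ) • X - (a * (X ⬝ᵥ v)) • Z - (a * (X ⬝ᵥ u)) • W) := by
    simp only [hS, sub_mulVec, smul_mulVec, add_mulVec, vecMulVec_mulVec, mulVec_sub, mulVec_smul,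
      ← hu, ← hv, dotProduct_comm X]
    ext i
    simp
    ring
  have hfe : f = powMulExp (complexForm u) (complexBilin S) k := by
    funext x
    rw [hf, powMulExp, complexForm_apply, complexBilin_apply, hSmul]
    simp only [hsum, mulVec_sub, mulVec_smul, dotProduct_sub, dotProduct_smul, smul_eq_mul,
      ← hu, ← hv]
    congr 2
    ring
  refine ⟨hfe ▸ contDiff_powMulExp _ _ _, fun x => ?_⟩
  have hmain := sum_mul_fderiv_fderiv_powMulExp H S hSsymm u k (by rw [hdual, hZZ']) hHsymm x
  have hac : a * c = 4 * Real.pi := by rw [ha]; field_simp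
  have hWZ : W ⬝ᵥ u = c := by rw [hu, hcomm, hZW]
  have htr : (H * S).trace = 2 * Real.pi * N - 8 * Real.pi := by
    have hHu : H *ᵥ u = Z := by rw [hu, mulVec_mulVec, hHG, one_mulVec]
    have hHv : H *ᵥ v = W := by rw [hv, mulVec_mulVec, hHG, one_mulVec]
    simp only [hS, mul_sub, Matrix.mul_smul, mul_add, hHG, mul_vecMulVec, hHu, hHv, trace_sub,
      trace_smul, trace_add, trace_vecMulVec, trace_one, Fintype.card_fin, smul_eq_mul, hZW, hWZ]
    linear_combination (-2) * hac
  set X : Fin N → ℂ := fun i => (x i : ℂ) with hX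
  have hLu : complexForm u x = X ⬝ᵥ u := complexForm_apply u x
  have hlin : u ⬝ᵥ H *ᵥ (S *ᵥ X) = -2 * Real.pi * (X ⬝ᵥ u) := by
    rw [hSmul, hu, hdual]
    simp only [mulVec_sub, mulVec_smul, dotProduct_sub, dotProduct_smul, smul_eq_mul, hcomm Z X,
      ← hu, ← hv, hZZ', hZW]
    linear_combination (-(X ⬝ᵥ u)) * hac
  have hquad : (S *ᵥ X) ⬝ᵥ H *ᵥ (S *ᵥ X) = 4 * Real.pi ^ 2 * (X ⬝ᵥ G *ᵥ X) := by
    rw [hSmul, hdual]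
    simp only [mulVec_sub, mulVec_smul, dotProduct_sub, dotProduct_smul, sub_dotProduct,
      smul_dotProduct, smul_eq_mul, hcomm Z X, hcomm W X, ← hu, ← hv, hZZ', hZW, hWW, hWZ]
    linear_combination (2 * a * (X ⬝ᵥ u) * (X ⬝ᵥ v)) * hac
  have hpow : (k : ℂ) * (X ⬝ᵥ u) * powMulExp (complexForm u) (complexBilin S) (k - 1) x =
      k * f x := by
    rw [hfe, ← hLu]
    cases k with
    | zero => simp
    | succ m => simp only [powMulExp, Nat.add_sub_cancel]; ring
  rw [hlin, hquad, htr, ← hfe] at hmain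
  have hmain' : ∑ i, ∑ j, (ginv i j : ℂ) *
      fderiv ℝ (fun y : Fin N → ℝ => fderiv ℝ f y (Pi.single j 1)) x (Pi.single i 1) = _ := hmain
  rw [hsum, hmain']
  linear_combination (-2 * Real.pi : ℂ) * hpow
end
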